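/- Suppose the Fourier cosine coefficients a_ℓ := 2∫W(θ)cos(ℓθ)dμ(θ) of W attain a positive maximum a := max_{ℓ≥1} a_ℓ > 0, and set κ* := 2/a. Suppose there are δ > 0, a nonempty finite set Λ′ ⊆ {i ≥ 1 : a_i = a}, nonzero reals (y_i)_{i∈Λ′}, a constant C > 0, a map s ↦ κ_s from [0,δ) to (0,∞) with κ_s < κ* for all s ∈ (0,δ), and a family (p_s)_{s∈[0,δ)} of strictly positive, even, 2π-periodic, continuously differentiable probability densities (∫p_s dμ = 1) such that: (a) (s,θ) ↦ p_s(θ) and (s,θ) ↦ ∂_s p_s(θ) exist and are jointly continuous; (b) p_0 ≡ 1; (c) for each s, p_s′(θ) = κ_s (W⋆p_s)′(θ) p_s(θ) for all θ; (d) writing p_ℓ(s) := ∫ p_s(θ)cos(ℓθ)dμ(θ), for all s ∈ [0,δ): (∑_{ℓ≥1}(1+ℓ²)(p_ℓ(s) − s·y_ℓ·1_{ℓ∈Λ′})²)^{1/2} ≤ C s² and (∑_{ℓ≥1}(1+ℓ²)(∂_s p_ℓ(s) − y_ℓ·1_{ℓ∈Λ′})²)^{1/2} ≤ C s. Then there exists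 η ∈ (0,δ) with 𝓕(p_η, κ*) < 𝓕(p_0, κ*); in particular, the uniform density is not a global minimizer of the free energy 𝓕(·, κ*). -/

import Mathlib

open scoped BigOperators
open Filter Topology Real MeasureTheory

noncomputable section

/-- The normalized Lebesgue measure `μ = (1/2π) dθ` on `[0, 2π)`. -/
def circleμ : Measure ℝ :=
  (ENNReal.ofReal (1 / (2 * π))) • (volume.restrict (Set.Ico (0:ℝ) (2 * π)))

/-- An admissible density: measurable, a.e. nonnegative, with total mass one and finite
entropy integral `∫ ρ |log ρ| dμ < ∞` (with the convention `0 · log 0 = 0`). -/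
def IsAdmissible (ρ : ℝ → ℝ) : Prop :=
  Measurable ρ ∧ (∀ᵐ θ ∂circleμ, 0 ≤ ρ θ) ∧ (∫ θ, ρ θ ∂circleμ) = 1 ∧
    Integrable (fun θ => ρ θ * |Real.log (ρ θ)|) circleμ

/-- The interaction energy `𝓔(ρ,ρ) = ∬ W(θ−φ) ρ(θ) ρ(φ) dμ(θ) dμ(φ)`. -/
def interactionE (W ρ : ℝ → ℝ) : ℝ :=
  ∫ θ, (∫ φ, W (θ - φ) * ρ θ * ρ φ ∂circleμ) ∂circleμ

/-- The free energy `𝓕(ρ,κ) = ∫ ρ log ρ dμ − (κ/2) 𝓔(ρ,ρ)`. -/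
def freeEnergy (W : ℝ → ℝ) (ρ : ℝ → ℝ) (κ : ℝ) : ℝ :=
  (∫ θ, ρ θ * Real.log (ρ θ) ∂circleμ) - κ / 2 * interactionE W ρ

/-- The minimum free energy `m(κ)`. -/
def minFreeEnergy (W : ℝ → ℝ) (κ : ℝ) : ℝ :=
  sInf {v : ℝ | ∃ ρ : ℝ → ℝ, IsAdmissible ρ ∧ v = freeEnergy W ρ κ}

/-- The set of global minimizers `M(κ)`. -/
def minimizers (W : ℝ → ℝ) (κ : ℝ) : Set (ℝ → ℝ) :=
  {ρ | IsAdmissible ρ ∧ freeEnergy W ρ κ = minFreeEnergy W κ}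

/-- The Fourier cosine coefficient of the potential: `a_ℓ = 2 ∫ W(θ) cos(ℓθ) dμ(θ)`. -/
def potCoef (W : ℝ → ℝ) (ℓ : ℕ) : ℝ := 2 * ∫ θ, W θ * Real.cos ((ℓ : ℝ) * θ) ∂circleμ

/-- The Fourier cosine coefficient of a density: `ρ_ℓ = ∫ ρ(θ) cos(ℓθ) dμ(θ)`. -/
def denCoef (ρ : ℝ → ℝ) (ℓ : ℕ) : ℝ := ∫ θ, ρ θ * Real.cos ((ℓ : ℝ) * θ) ∂circleμ

section general
variable {X : Type*} [TopologicalSpace X] [MeasurableSpace X] [OpensMeasurableSpace X]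

theorem aux_integrable {μ : Measure X} [IsFiniteMeasure μ] {K : Set X} (hK : IsCompact K)
    (hμ : ∀ᵐ x ∂μ, x ∈ K) {f : X → ℝ} (hf : Continuous f) : Integrable f μ := by
  obtain ⟨M, hM⟩ := hK.exists_bound_of_continuousOn hf.continuousOn
  exact Integrable.of_bound hf.aestronglyMeasurable M (hμ.mono fun x hx => hM x hx)

theorem aux_slice {Y : Type*} [TopologicalSpace Y] {U : Set Y} {h : Y → X → ℝ}
    (hc : ContinuousOn (fun q : Y × X => h q.1 q.2) (U ×ˢ (Set.univ : Set X)))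
    {s : Y} (hs : s ∈ U) : Continuous (h s) := by
  have : ContinuousOn (fun x : X => h s x) Set.univ :=
    hc.comp (f := fun x : X => (s, x)) (by fun_prop) (fun x _ => ⟨hs, Set.mem_univ _⟩)
  exact continuousOn_univ.1 this

theorem aux_hasDerivAt {μ : Measure X} [IsFiniteMeasure μ] {K : Set X} (hK : IsCompact K)
    (hμ : ∀ᵐ x ∂μ, x ∈ K) {U : Set ℝ} (hU : IsOpen U) {h h' : ℝ → X → ℝ}
    (hc : ∀ s ∈ U, Continuous (h s))
    (hc' : ContinuousOn (fun q : ℝ × X => h' q.1 q.2) (U ×ˢ (Set.univ : Set X)))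
    (hd : ∀ s ∈ U, ∀ x, HasDerivAt (fun t => h t x) (h' s x) s) {s : ℝ} (hs : s ∈ U) :
    HasDerivAt (fun t => ∫ x, h t x ∂μ) (∫ x, h' s x ∂μ) s := by
  obtain ⟨ε, hε, hεU⟩ := Metric.nhds_basis_closedBall.mem_iff.1 (hU.mem_nhds hs)
  obtain ⟨M, hM⟩ := ((isCompact_closedBall s ε).prod hK).exists_bound_of_continuousOn
    (hc'.mono (Set.prod_mono hεU (Set.subset_univ _)))
  refine (hasDerivAt_integral_of_dominated_loc_of_deriv_le (bound := fun _ => M)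
    (Metric.closedBall_mem_nhds s hε) ?_ (aux_integrable hK hμ (hc s hs))
    (aux_slice hc' hs).aestronglyMeasurable ?_ (integrable_const _) ?_).2
  · filter_upwards [hU.mem_nhds hs] with t ht using (hc t ht).aestronglyMeasurable
  · filter_upwards [hμ] with x hx t ht using hM (t, x) ⟨ht, hx⟩
  · exact Filter.Eventually.of_forall fun x t ht => hd t (hεU ht) x

theorem aux_continuousOn {μ : Measure X} [IsFiniteMeasure μ] {K : Set X} (hK : IsCompact K)
    (hμ : ∀ᵐ x ∂μ, x ∈ K) {I : Set ℝ} (hI : IsCompact I) {h : ℝ → X → ℝ}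
    (hc : ContinuousOn (fun q : ℝ × X => h q.1 q.2) (I ×ˢ (Set.univ : Set X))) :
    ContinuousOn (fun t => ∫ x, h t x ∂μ) I := by
  obtain ⟨M, hM⟩ := (hI.prod hK).exists_bound_of_continuousOn
    (hc.mono (Set.prod_mono le_rfl (Set.subset_univ _)))
  refine continuousOn_of_dominated (bound := fun _ => M)
    (fun t ht => (aux_slice hc ht).aestronglyMeasurable) ?_ (integrable_const _) ?_
  · intro t ht
    filter_upwards [hμ] with x hx using hM (t, x) ⟨ht, hx⟩
  · refine Filter.Eventually.of_forall fun x => ?_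
    exact hc.comp (f := fun t : ℝ => (t, x)) (by fun_prop) (fun t ht => ⟨ht, Set.mem_univ _⟩)

end general

instance : IsProbabilityMeasure circleμ := by
  constructor
  simp only [circleμ, Measure.smul_apply, Measure.restrict_apply_univ, Real.volume_Ico, sub_zero,
    smul_eq_mul]
  rw [← ENNReal.ofReal_mul (by positivity)]
  have := Real.pi_pos
  rw [one_div, inv_mul_cancel₀ (by positivity), ENNReal.ofReal_one]

theorem circle_ae : ∀ᵐ x ∂circleμ, x ∈ Set.Icc (0:ℝ) (2 * π) := by
  refine Measure.ae_smul_measure ?_ _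
  filter_upwards [ae_restrict_mem measurableSet_Ico] with x hx using ⟨hx.1, hx.2.le⟩

theorem circle_ae2 : ∀ᵐ z ∂(circleμ.prod circleμ),
    z ∈ Set.Icc (0:ℝ) (2 * π) ×ˢ Set.Icc (0:ℝ) (2 * π) := by
  have h1 : ∀ᵐ z ∂(circleμ.prod circleμ), z.1 ∈ Set.Icc (0:ℝ) (2 * π) :=
    Measure.quasiMeasurePreserving_fst.ae circle_ae
  have h2 : ∀ᵐ z ∂(circleμ.prod circleμ), z.2 ∈ Set.Icc (0:ℝ) (2 * π) :=
    Measure.quasiMeasurePreserving_snd.ae circle_ae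
  filter_upwards [h1, h2] with z a b using ⟨a, b⟩

theorem circle_int {f : ℝ → ℝ} (hf : Continuous f) : Integrable f circleμ :=
  aux_integrable isCompact_Icc circle_ae hf

theorem circle_int2 {f : ℝ × ℝ → ℝ} (hf : Continuous f) : Integrable f (circleμ.prod circleμ) :=
  aux_integrable (isCompact_Icc.prod isCompact_Icc) circle_ae2 hf

theorem circle_eq (f : ℝ → ℝ) :
    ∫ x, f x ∂circleμ = (1 / (2 * π)) * ∫ x in (0:ℝ)..(2 * π), f x := by
  have := Real.pi_pos
  rw [circleμ, integral_smul_measure, ENNReal.toReal_ofReal (by positivity),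
    intervalIntegral.integral_of_le (by positivity), integral_Ico_eq_integral_Ioc, smul_eq_mul]

/-- reflection plus translation -/
theorem circle_sub_left {f : ℝ → ℝ} (hf : Function.Periodic f (2 * π)) (c : ℝ) :
    ∫ x, f (c - x) ∂circleμ = ∫ x, f x ∂circleμ := by
  rw [circle_eq, circle_eq, intervalIntegral.integral_comp_sub_left]
  have := hf.intervalIntegral_add_eq (c - 2 * π) 0
  simp only [sub_add_cancel, zero_add] at this
  rw [sub_zero, this]

theorem circle_sub_right {f : ℝ → ℝ} (hf : Function.Periodic f (2 * π)) (c : ℝ) :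
    ∫ x, f (x - c) ∂circleμ = ∫ x, f x ∂circleμ := by
  rw [circle_eq, circle_eq, intervalIntegral.integral_comp_sub_right]
  have := hf.intervalIntegral_add_eq (0 - c) 0
  simp only [zero_add] at this
  rw [← this]; congr 2; ring

theorem circle_odd {f : ℝ → ℝ} (hf : Function.Periodic f (2 * π)) (ho : ∀ x, f (-x) = - f x) :
    ∫ x, f x ∂circleμ = 0 := by
  have h := circle_sub_left hf 0
  simp only [zero_sub, ho, integral_neg] at h
  linarith

theorem fourier_expand {T : ℝ} (hT : T = 2 * π) (n : ℤ) (x : ℝ) :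
    fourier (-n) (x : AddCircle T) = ((Real.cos (n * x) : ℝ) : ℂ)
      - ((Real.sin (n * x) : ℝ) : ℂ) * Complex.I := by
  subst hT
  rw [fourier_coe_apply]
  have h : (2 * π * Complex.I * (-n : ℤ) * x / ((2 * π : ℝ) : ℂ) : ℂ)
      = ((-(n * x) : ℝ) : ℂ) * Complex.I := by
    have : (π : ℂ) ≠ 0 := by exact_mod_cast Real.pi_ne_zero
    push_cast
    field_simp
  rw [h, Complex.exp_mul_I, ← Complex.ofReal_cos, ← Complex.ofReal_sin, Real.cos_neg, Real.sin_neg]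
  push_cast; ring

theorem cos_per (n : ℤ) : Function.Periodic (fun x : ℝ => Real.cos (n * x)) (2 * π) := by
  intro x
  simp only [mul_add]
  exact Real.cos_add_int_mul_two_pi _ _

theorem sin_per (n : ℤ) : Function.Periodic (fun x : ℝ => Real.sin (n * x)) (2 * π) := by
  intro x
  simp only [mul_add]
  exact Real.sin_add_int_mul_two_pi _ _

theorem fourier_integral {T : ℝ} (hT : T = 2 * π) {f : ℝ → ℝ} (hf : Continuous f)
    (hp : Function.Periodic f (2 * π)) (he : ∀ x, f (-x) = f x) (n : ℤ) :
    (1 / T) • ∫ x in (0:ℝ)..(2 * π), fourier (-n) (x : AddCircle T) • (f x : ℂ)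
      = (denCoef f n.natAbs : ℂ) := by
  have e : ∀ x : ℝ, fourier (-n) (x : AddCircle T) • (f x : ℂ)
      = ((f x * Real.cos (n * x) : ℝ) : ℂ) - ((f x * Real.sin (n * x) : ℝ) : ℂ) * Complex.I := by
    intro x
    rw [fourier_expand hT, smul_eq_mul]; push_cast; ring
  simp_rw [e]
  have c1 : Continuous fun x : ℝ => f x * Real.cos (n * x) := by fun_prop
  have c2 : Continuous fun x : ℝ => f x * Real.sin (n * x) := by fun_prop
  have i1 : IntervalIntegrable (fun x : ℝ => ((f x * Real.cos (n * x) : ℝ) : ℂ)) volume 0 (2 * π) :=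
    (Complex.continuous_ofReal.comp c1).intervalIntegrable _ _
  have i2 : IntervalIntegrable (fun x : ℝ => ((f x * Real.sin (n * x) : ℝ) : ℂ) * Complex.I)
      volume 0 (2 * π) :=
    ((Complex.continuous_ofReal.comp c2).mul continuous_const).intervalIntegrable _ _
  rw [intervalIntegral.integral_sub i1 i2,
    intervalIntegral.integral_mul_const, intervalIntegral.integral_ofReal,
    intervalIntegral.integral_ofReal]
  have h0 : ∫ x, f x * Real.sin (n * x) ∂circleμ = 0 := by
    apply circle_odd (hp.mul (sin_per n))
    intro x
    simp [he]
  have h1 : denCoef f n.natAbs = ∫ x, f x * Real.cos (n * x) ∂circleμ := by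
    unfold denCoef
    congr 1; ext x; congr 1
    rcases Int.natAbs_eq n with h | h
    · conv_rhs => rw [h]
      simp
    · conv_rhs => rw [h]
      simp
  rw [h1]
  rw [circle_eq] at h0 ⊢
  have hpi := Real.pi_pos
  have h0' : ∫ x in (0:ℝ)..(2 * π), f x * Real.sin (n * x) = 0 := by
    rcases mul_eq_zero.1 h0 with h | h
    · have : 0 < 1 / (2 * π) := by positivity
      linarith
    · exact h
  rw [h0', hT]
  simp

theorem fourier_zero_of_coef {f : ℝ → ℝ} (hf : Continuous f)
    (hp : Function.Periodic f (2 * π)) (he : ∀ x, f (-x) = f x)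
    (h0 : ∀ ℓ, denCoef f ℓ = 0) (x : ℝ) : f x = 0 := by
  have : Fact (0 < 2 * π) := ⟨by have := Real.pi_pos; positivity⟩
  have hp' : Function.Periodic (fun x => (f x : ℂ)) (2 * π) := fun x => by simp [hp x]
  let g : C(AddCircle (2 * π), ℂ) := ⟨hp'.lift, by
    apply continuous_coinduced_dom.2
    exact Complex.continuous_ofReal.comp hf⟩
  have hg : ∀ x : ℝ, g (x : AddCircle (2 * π)) = (f x : ℂ) := fun x => rfl
  have hz : ∀ n, fourierCoeff g n = 0 := by
    intro n
    rw [fourierCoeff_eq_intervalIntegral _ n 0]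
    simp_rw [hg, zero_add]
    rw [fourier_integral rfl hf hp he, h0]; simp
  have hz' : fourierCoeff g = fun _ => 0 := funext hz
  have hs := has_pointwise_sum_fourier_series_of_summable (f := g)
    (by rw [hz']; exact summable_zero) (x : AddCircle (2 * π))
  simp only [hz, zero_smul] at hs
  have := hs.unique hasSum_zero
  rw [hg] at this
  exact_mod_cast this

theorem summable_coef {f : ℝ → ℝ} (hf : ContDiff ℝ 1 f)
    (hp : Function.Periodic f (2 * π)) (he : ∀ x, f (-x) = f x) :
    Summable (fun n : ℕ => (n : ℝ) ^ 2 * denCoef f n ^ 2) := by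
  have h2 : (0:ℝ) < 2 * π := by have := Real.pi_pos; positivity
  have hc' : Continuous fun x => ((deriv f x : ℝ) : ℂ) :=
    Complex.continuous_ofReal.comp (hf.continuous_deriv le_rfl)
  have hs : Summable fun n : ℤ => ‖fourierCoeffOn h2 (fun x => ((deriv f x : ℝ) : ℂ)) n‖ ^ 2 := by
    refine (hasSum_sq_fourierCoeffOn h2 ?_).summable
    have hm : MemLp (fun x => ((deriv f x : ℝ) : ℂ)) 2 (volume.restrict (Set.Icc 0 (2 * π))) := by
      obtain ⟨M, hM⟩ := (isCompact_Icc (a := (0:ℝ)) (b := 2 * π)).exists_bound_of_continuousOn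
        hc'.continuousOn
      refine MemLp.of_bound hc'.aestronglyMeasurable M ?_
      filter_upwards [ae_restrict_mem measurableSet_Icc] with x hx using hM x hx
    exact hm.mono_measure (Measure.restrict_mono Set.Ioc_subset_Icc_self le_rfl)
  have hs' := hs.comp_injective Nat.cast_injective
  refine Summable.of_nonneg_of_le (fun n => by positivity) (fun n => ?_) hs'
  simp only [Function.comp]
  by_cases hn : n = 0
  · subst hn
    simp only [Nat.cast_zero, ne_eq, OfNat.ofNat_ne_zero, not_false_eq_true, zero_pow, zero_mul]
    positivity
  have hn' : ((n : ℤ)) ≠ 0 := by exact_mod_cast hn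
  have key := fourierCoeffOn_of_hasDerivAt h2 (f := fun x => (f x : ℂ)) hn'
    (fun x _ => (((hf.differentiable one_ne_zero) x).hasDerivAt).ofReal_comp)
    (hc'.intervalIntegrable _ _)
  have hper : f (2 * π) = f 0 := by simpa using hp 0
  rw [fourierCoeffOn_eq_integral, fourier_integral (by simp) hf.continuous hp he,
    hper, sub_self, mul_zero, zero_sub] at key
  have e2 : (n : ℝ) * |denCoef f n| = ‖fourierCoeffOn h2 (fun x => ((deriv f x : ℝ) : ℂ)) n‖ := by
    have hk := congrArg norm key
    simp only [Int.natAbs_natCast, Complex.norm_real, Real.norm_eq_abs, norm_mul, norm_div,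
      norm_neg, norm_one, Complex.norm_I, Complex.ofReal_zero, sub_zero, Int.cast_natCast,
      Complex.norm_natCast, Complex.norm_ofNat, Complex.ofReal_mul, Complex.ofReal_ofNat,
      abs_of_pos Real.pi_pos, mul_one] at hk
    rw [hk]
    have : (n:ℝ) ≠ 0 := by exact_mod_cast hn
    have := Real.pi_ne_zero
    field_simp
  rw [← e2, mul_pow, sq_abs]

/-- convolution against the potential -/
def cconv (W g : ℝ → ℝ) (θ : ℝ) : ℝ := ∫ φ, W (θ - φ) * g φ ∂circleμ

theorem cconv_cont {W g : ℝ → ℝ} (hW : Continuous W) (hg : Continuous g) :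
    Continuous (cconv W g) := by
  rw [continuous_iff_continuousAt]
  intro θ
  have h := aux_continuousOn (μ := circleμ) isCompact_Icc circle_ae
    (isCompact_Icc (a := θ - 1) (b := θ + 1)) (h := fun t φ => W (t - φ) * g φ)
    (Continuous.continuousOn (by fun_prop))
  exact h.continuousAt (Icc_mem_nhds (by linarith) (by linarith))

theorem cconv_swap {W g : ℝ → ℝ} (hWp : Function.Periodic W (2 * π))
    (hgp : Function.Periodic g (2 * π)) (θ : ℝ) :
    cconv W g θ = ∫ ψ, W ψ * g (θ - ψ) ∂circleμ := by
  have hp : Function.Periodic (fun φ => W (θ - φ) * g φ) (2 * π) := by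
    intro φ
    simp only [hgp φ]
    rw [← sub_sub, hWp.sub_eq]
  have h := circle_sub_left hp θ
  simp only [sub_sub_cancel] at h
  exact h.symm

theorem cconv_diff {W g : ℝ → ℝ} (hW : Continuous W) (hWp : Function.Periodic W (2 * π))
    (hg : ContDiff ℝ 1 g) (hgp : Function.Periodic g (2 * π)) :
    Differentiable ℝ (cconv W g) := by
  intro θ
  have e : cconv W g = fun θ => ∫ ψ, W ψ * g (θ - ψ) ∂circleμ := funext (cconv_swap hWp hgp)
  rw [e]
  have hgc := hg.continuous
  have hgd := hg.continuous_deriv le_rfl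
  refine (aux_hasDerivAt (μ := circleμ) isCompact_Icc circle_ae isOpen_univ
    (h := fun θ ψ => W ψ * g (θ - ψ)) (h' := fun θ ψ => W ψ * deriv g (θ - ψ))
    (fun s _ => by fun_prop) (Continuous.continuousOn (by fun_prop)) ?_
    (Set.mem_univ θ)).differentiableAt
  intro s _ x
  have := ((hg.differentiable one_ne_zero) (s - x)).hasDerivAt.comp_sub_const s x
  exact this.const_mul _

theorem cconv_even {W g : ℝ → ℝ} (hWe : ∀ θ, W (-θ) = W θ) (hWp : Function.Periodic W (2 * π))
    (hgp : Function.Periodic g (2 * π)) (hge : ∀ θ, g (-θ) = g θ) (θ : ℝ) :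
    cconv W g (-θ) = cconv W g θ := by
  have hp : Function.Periodic (fun φ => W (θ - φ) * g φ) (2 * π) := by
    intro φ
    simp only [hgp φ]
    rw [← sub_sub, hWp.sub_eq]
  have h := circle_sub_left hp 0
  simp only [zero_sub, hge, sub_neg_eq_add] at h
  unfold cconv
  rw [← h]
  congr 1; ext φ
  rw [← hWe (-θ - φ)]; congr 2; ring

theorem cconv_per {W g : ℝ → ℝ} (hWp : Function.Periodic W (2 * π)) :
    Function.Periodic (cconv W g) (2 * π) := by
  intro θ
  unfold cconv
  congr 1; ext φ
  rw [add_sub_right_comm, hWp]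

theorem cconv_coef {W g : ℝ → ℝ} (hW : Continuous W) (hWe : ∀ θ, W (-θ) = W θ)
    (hWp : Function.Periodic W (2 * π)) (hg : Continuous g) (ℓ : ℕ) :
    denCoef (cconv W g) ℓ = potCoef W ℓ / 2 * denCoef g ℓ := by
  have inner : ∀ φ, ∫ θ, W (θ - φ) * Real.cos (ℓ * θ) ∂circleμ
      = potCoef W ℓ / 2 * Real.cos (ℓ * φ) := by
    intro φ
    have hp : Function.Periodic (fun ψ => W ψ * Real.cos (ℓ * (ψ + φ))) (2 * π) := by
      intro ψ
      simp only [hWp ψ]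
      have := cos_per ℓ (ψ + φ)
      simp only [Int.cast_natCast] at this
      rw [← this]; ring_nf
    have h := circle_sub_right hp φ
    simp only [sub_add_cancel] at h
    rw [h]
    have e : ∀ ψ, W ψ * Real.cos (ℓ * (ψ + φ)) = (W ψ * Real.cos (ℓ * ψ)) * Real.cos (ℓ * φ)
        - (W ψ * Real.sin (ℓ * ψ)) * Real.sin (ℓ * φ) := by
      intro ψ; rw [mul_add, Real.cos_add]; ring
    simp_rw [e]
    rw [integral_sub (circle_int (by fun_prop)) (circle_int (by fun_prop)), integral_mul_const,
      integral_mul_const]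
    have hs : ∫ ψ, W ψ * Real.sin (ℓ * ψ) ∂circleμ = 0 := by
      apply circle_odd
      · have := hWp.mul (sin_per ℓ)
        simpa using this
      · intro x; simp [hWe]
    rw [hs, potCoef]; ring
  unfold denCoef cconv
  simp_rw [← integral_mul_const]
  rw [integral_integral_swap (circle_int2 (f := fun z : ℝ × ℝ =>
    W (z.1 - z.2) * g z.2 * Real.cos (ℓ * z.1)) (by fun_prop)), ← integral_const_mul]
  congr 1; ext φ
  have : ∀ θ, W (θ - φ) * g φ * Real.cos (ℓ * θ) = g φ * (W (θ - φ) * Real.cos (ℓ * θ)) := by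
    intro θ; ring
  simp_rw [this]
  rw [integral_const_mul, inner]; ring

theorem interaction_prod {W ρ : ℝ → ℝ} (hW : Continuous W) (hρ : Continuous ρ) :
    interactionE W ρ = ∫ z : ℝ × ℝ, W (z.1 - z.2) * ρ z.1 * ρ z.2 ∂(circleμ.prod circleμ) := by
  rw [integral_prod _ (circle_int2 (by fun_prop))]
  rfl

theorem log_const {W g : ℝ → ℝ} {κ : ℝ} (hW : Continuous W) (hWp : Function.Periodic W (2 * π))
    (hg : ContDiff ℝ 1 g) (hgp : Function.Periodic g (2 * π)) (hpos : ∀ θ, 0 < g θ)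
    (hst : ∀ θ, deriv g θ = κ * deriv (cconv W g) θ * g θ) :
    ∃ c, ∀ θ, Real.log (g θ) = κ * cconv W g θ + c := by
  have hd := cconv_diff hW hWp hg hgp
  have hgd := hg.differentiable one_ne_zero
  have h : ∀ θ, HasDerivAt (fun θ => Real.log (g θ) - κ * cconv W g θ) 0 θ := by
    intro θ
    have h1 := ((hgd θ).hasDerivAt.log (hpos θ).ne').sub ((hd θ).hasDerivAt.const_mul κ)
    refine h1.congr_deriv ?_
    rw [hst θ, mul_div_assoc, div_self (hpos θ).ne']
    ring
  have hc := is_const_of_deriv_eq_zero (fun θ => (h θ).differentiableAt) (fun θ => (h θ).deriv)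
  refine ⟨Real.log (g 0) - κ * cconv W g 0, fun θ => ?_⟩
  have := hc θ 0
  linarith

theorem deriv_free {W : ℝ → ℝ} (hWc : Continuous W) (hWe : ∀ θ, W (-θ) = W θ)
    (hWper : Function.Periodic W (2 * π)) {δ κ κ' : ℝ} {p ps : ℝ → ℝ → ℝ}
    (hpos : ∀ s ∈ Set.Ico (0:ℝ) δ, ∀ θ : ℝ, 0 < p s θ)
    (hper : ∀ s ∈ Set.Ico (0:ℝ) δ, Function.Periodic (p s) (2 * π))
    (hreg : ∀ s ∈ Set.Ico (0:ℝ) δ, ContDiff ℝ 1 (p s))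
    (hmass : ∀ s ∈ Set.Ico (0:ℝ) δ, (∫ θ, p s θ ∂circleμ) = 1)
    (hps : ∀ s ∈ Set.Ico (0:ℝ) δ, ∀ θ : ℝ, HasDerivAt (fun t => p t θ) (ps s θ) s)
    (hcont : ContinuousOn (fun q : ℝ × ℝ => p q.1 q.2) (Set.Ico (0:ℝ) δ ×ˢ (Set.univ : Set ℝ)))
    (hcont' : ContinuousOn (fun q : ℝ × ℝ => ps q.1 q.2) (Set.Ico (0:ℝ) δ ×ˢ (Set.univ : Set ℝ)))
    {s : ℝ} (hs : s ∈ Set.Ioo 0 δ)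
    (hst : ∀ θ, deriv (p s) θ = κ' * deriv (cconv W (p s)) θ * p s θ) :
    (∫ θ, ps s θ ∂circleμ) = 0 ∧
    HasDerivAt (fun t => freeEnergy W (p t) κ)
      ((κ' - κ) * ∫ z : ℝ × ℝ, W (z.1 - z.2) * ps s z.1 * p s z.2 ∂(circleμ.prod circleμ)) s := by
  have sub : Set.Ioo 0 δ ⊆ Set.Ico 0 δ := Set.Ioo_subset_Ico_self
  have hc : ContinuousOn (fun q : ℝ × ℝ => p q.1 q.2) (Set.Ioo (0:ℝ) δ ×ˢ (Set.univ : Set ℝ)) :=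
    hcont.mono (Set.prod_mono sub le_rfl)
  have hc' : ContinuousOn (fun q : ℝ × ℝ => ps q.1 q.2) (Set.Ioo (0:ℝ) δ ×ˢ (Set.univ : Set ℝ)) :=
    hcont'.mono (Set.prod_mono sub le_rfl)
  have pc : ∀ t ∈ Set.Ioo 0 δ, Continuous (p t) := fun t ht => aux_slice hc ht
  have psc : ∀ t ∈ Set.Ioo 0 δ, Continuous (ps t) := fun t ht => aux_slice hc' ht
  have hsn : Set.Ioo 0 δ ∈ 𝓝 s := isOpen_Ioo.mem_nhds hs
  -- mass
  have hm := aux_hasDerivAt (μ := circleμ) isCompact_Icc circle_ae isOpen_Ioo pc hc'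
    (fun s hs x => hps s (sub hs) x) hs
  have hm0 : (∫ θ, ps s θ ∂circleμ) = 0 := by
    refine hm.unique ((hasDerivAt_const s (1:ℝ)).congr_of_eventuallyEq ?_)
    filter_upwards [hsn] with t ht using hmass t (sub ht)
  refine ⟨hm0, ?_⟩
  have hlogc : ContinuousOn (fun q : ℝ × ℝ => Real.log (p q.1 q.2))
      (Set.Ioo (0:ℝ) δ ×ˢ (Set.univ : Set ℝ)) :=
    hc.log (fun q hq => (hpos _ (sub hq.1) _).ne')
  have hent := aux_hasDerivAt (μ := circleμ) isCompact_Icc circle_ae isOpen_Ioo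
    (h := fun t θ => p t θ * Real.log (p t θ)) (h' := fun t θ => ps t θ * (Real.log (p t θ) + 1))
    (fun t ht => (pc t ht).mul ((pc t ht).log fun x => (hpos t (sub ht) x).ne'))
    (hc'.mul (hlogc.add continuousOn_const))
    (fun t ht x => by
      have h1 := (hps t (sub ht) x)
      have h2 := h1.mul (h1.log (hpos t (sub ht) x).ne')
      refine h2.congr_deriv ?_
      have := (hpos t (sub ht) x).ne'
      field_simp) hs
  have g1 : ContinuousOn (fun q : ℝ × ℝ × ℝ => p q.1 q.2.1)
      (Set.Ioo (0:ℝ) δ ×ˢ (Set.univ : Set (ℝ × ℝ))) :=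
    hc.comp (f := fun q : ℝ × ℝ × ℝ => (q.1, q.2.1)) (by fun_prop)
      (fun q hq => ⟨hq.1, Set.mem_univ _⟩)
  have g2 : ContinuousOn (fun q : ℝ × ℝ × ℝ => p q.1 q.2.2)
      (Set.Ioo (0:ℝ) δ ×ˢ (Set.univ : Set (ℝ × ℝ))) :=
    hc.comp (f := fun q : ℝ × ℝ × ℝ => (q.1, q.2.2)) (by fun_prop)
      (fun q hq => ⟨hq.1, Set.mem_univ _⟩)
  have g1' : ContinuousOn (fun q : ℝ × ℝ × ℝ => ps q.1 q.2.1)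
      (Set.Ioo (0:ℝ) δ ×ˢ (Set.univ : Set (ℝ × ℝ))) :=
    hc'.comp (f := fun q : ℝ × ℝ × ℝ => (q.1, q.2.1)) (by fun_prop)
      (fun q hq => ⟨hq.1, Set.mem_univ _⟩)
  have g2' : ContinuousOn (fun q : ℝ × ℝ × ℝ => ps q.1 q.2.2)
      (Set.Ioo (0:ℝ) δ ×ˢ (Set.univ : Set (ℝ × ℝ))) :=
    hc'.comp (f := fun q : ℝ × ℝ × ℝ => (q.1, q.2.2)) (by fun_prop)
      (fun q hq => ⟨hq.1, Set.mem_univ _⟩)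
  have gW : ContinuousOn (fun q : ℝ × ℝ × ℝ => W (q.2.1 - q.2.2))
      (Set.Ioo (0:ℝ) δ ×ˢ (Set.univ : Set (ℝ × ℝ))) := Continuous.continuousOn (by fun_prop)
  have hint := aux_hasDerivAt (μ := circleμ.prod circleμ) (isCompact_Icc.prod isCompact_Icc)
    circle_ae2 isOpen_Ioo
    (h := fun t z => W (z.1 - z.2) * p t z.1 * p t z.2)
    (h' := fun t z => W (z.1 - z.2) * ps t z.1 * p t z.2 + W (z.1 - z.2) * p t z.1 * ps t z.2)
    (fun t ht => by have := pc t ht; fun_prop)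
    (((gW.mul g1').mul g2).add ((gW.mul g1).mul g2'))
    (fun t ht z =>
      ((hps t (sub ht) z.1).const_mul _).mul (hps t (sub ht) z.2)) hs
  have pcs := pc s hs
  have pscs := psc s hs
  set D := ∫ z : ℝ × ℝ, W (z.1 - z.2) * ps s z.1 * p s z.2 ∂(circleμ.prod circleμ) with hD
  have hsym : ∫ z : ℝ × ℝ, W (z.1 - z.2) * p s z.1 * ps s z.2 ∂(circleμ.prod circleμ) = D := by
    rw [hD, ← integral_prod_swap]
    congr 1; ext z
    simp only [Prod.fst_swap, Prod.snd_swap]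
    rw [← hWe (z.1 - z.2), neg_sub]; ring
  rw [integral_add (circle_int2 (by fun_prop)) (circle_int2 (by fun_prop)), hsym] at hint
  obtain ⟨c, hcst⟩ := log_const hWc hWper (hreg s (sub hs)) (hper s (sub hs)) (hpos s (sub hs)) hst
  have hDc : D = ∫ θ, ps s θ * cconv W (p s) θ ∂circleμ := by
    rw [hD, integral_prod _ (circle_int2 (by fun_prop))]
    congr 1; ext θ
    unfold cconv
    rw [← integral_const_mul]
    congr 1; ext φ; ring
  have hcc := cconv_cont hWc pcs
  have hS : ∫ θ, ps s θ * (Real.log (p s θ) + 1) ∂circleμ = κ' * D := by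
    simp_rw [hcst]
    have e : ∀ θ, ps s θ * (κ' * cconv W (p s) θ + c + 1)
        = κ' * (ps s θ * cconv W (p s) θ) + (c + 1) * ps s θ := by intro θ; ring
    simp_rw [e]
    rw [integral_add (circle_int (by fun_prop)) (circle_int (by fun_prop)), integral_const_mul,
      integral_const_mul, hm0, ← hDc]; ring
  rw [hS] at hent
  have hfin := hent.sub (hint.const_mul (κ / 2))
  have hfin' := hfin.congr_of_eventuallyEq (f₁ := fun t => freeEnergy W (p t) κ) (by
    filter_upwards [hsn] with t ht
    simp only [freeEnergy, interaction_prod hWc (pc t ht)]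
    rfl)
  refine hfin'.congr_deriv ?_
  ring

theorem coef_bound {f : ℝ → ℝ} (hf : ContDiff ℝ 1 f)
    (hp : Function.Periodic f (2 * π)) (he : ∀ x, f (-x) = f x) {Λ : Finset ℕ} {y : ℕ → ℝ}
    {s B : ℝ} (h : Real.sqrt (∑' ℓ : ℕ, (1 + ((ℓ + 1 : ℕ) : ℝ) ^ 2)
          * (denCoef f (ℓ + 1) - s * (if (ℓ + 1) ∈ Λ then y (ℓ + 1) else 0)) ^ 2) ≤ B) (ℓ : ℕ) :
    |denCoef f (ℓ + 1) - s * (if (ℓ + 1) ∈ Λ then y (ℓ + 1) else 0)| ≤ B := by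
  set c : ℕ → ℝ := fun n => if n ∈ Λ then y n else 0 with hc
  have h1 : Summable fun n : ℕ => 4 * ((n : ℝ) ^ 2 * denCoef f n ^ 2)
      + 2 * ((1 + (n:ℝ) ^ 2) * (s * c n) ^ 2) := by
    refine ((summable_coef hf hp he).mul_left 4).add (Summable.mul_left 2 ?_)
    refine summable_of_ne_finset_zero (s := Λ) fun n hn => ?_
    simp [hc, hn]
  have h2 := (summable_nat_add_iff 1).2 h1
  have h3 : Summable fun ℓ : ℕ => (1 + ((ℓ + 1 : ℕ) : ℝ) ^ 2)
          * (denCoef f (ℓ + 1) - s * c (ℓ + 1)) ^ 2 := by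
    refine Summable.of_nonneg_of_le (fun n => by positivity) (fun n => ?_) h2
    have hn : (1:ℝ) ≤ ((n + 1 : ℕ) : ℝ) ^ 2 := by
      have : (1:ℝ) ≤ ((n + 1 : ℕ) : ℝ) := by exact_mod_cast Nat.le_add_left 1 n
      nlinarith
    set N : ℝ := ((n + 1 : ℕ) : ℝ) ^ 2
    set d := denCoef f (n + 1)
    set e := s * c (n + 1)
    nlinarith [mul_nonneg (by linarith : (0:ℝ) ≤ 1 + N) (sq_nonneg (d + e)),
      mul_nonneg (by linarith : (0:ℝ) ≤ N - 1) (sq_nonneg d)]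
  refine le_trans ?_ h
  apply Real.le_sqrt_of_sq_le
  have h4 := h3.le_tsum ℓ (fun n _ => by positivity)
  refine le_trans ?_ h4
  rw [sq_abs]
  have : 0 ≤ ((ℓ + 1 : ℕ) : ℝ) ^ 2 := by positivity
  nlinarith [mul_nonneg this (sq_nonneg (denCoef f (ℓ + 1) - s * c (ℓ + 1)))]

/-- given a `C¹` family of stationary densities `p_s` at intensities
`κ_s < κ* = 2/a` bifurcating from the uniform density along the dominant modes `Λ′`,
the free energy at `κ*` strictly decreases along the branch, so the uniform density is
not a global minimizer of `𝓕(·, κ*)`. -/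
theorem subcritical_branch_lowers_free_energy
    (W : ℝ → ℝ) (hWc : Continuous W) (hWe : ∀ θ, W (-θ) = W θ)
    (hWper : Function.Periodic W (2 * π))
    (aval : ℝ) (hav : 0 < aval)
    (hub : ∀ ℓ : ℕ, 1 ≤ ℓ → potCoef W ℓ ≤ aval)
    (hattain : ∃ ℓ : ℕ, 1 ≤ ℓ ∧ potCoef W ℓ = aval)
    (δ : ℝ) (hδ : 0 < δ)
    (Λ : Finset ℕ) (hΛne : Λ.Nonempty)
    (hΛ : ∀ i ∈ Λ, 1 ≤ i ∧ potCoef W i = aval)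
    (y : ℕ → ℝ) (hy : ∀ i ∈ Λ, y i ≠ 0)
    (C : ℝ) (hC : 0 < C)
    (κs : ℝ → ℝ)
    (hκpos : ∀ s ∈ Set.Ico (0:ℝ) δ, 0 < κs s)
    (hκlt : ∀ s ∈ Set.Ioo (0:ℝ) δ, κs s < 2 / aval)
    (p ps : ℝ → ℝ → ℝ)
    (hpos : ∀ s ∈ Set.Ico (0:ℝ) δ, ∀ θ : ℝ, 0 < p s θ)
    (heven : ∀ s ∈ Set.Ico (0:ℝ) δ, ∀ θ : ℝ, p s (-θ) = p s θ)
    (hper : ∀ s ∈ Set.Ico (0:ℝ) δ, Function.Periodic (p s) (2 * π))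
    (hreg : ∀ s ∈ Set.Ico (0:ℝ) δ, ContDiff ℝ 1 (p s))
    (hmass : ∀ s ∈ Set.Ico (0:ℝ) δ, (∫ θ, p s θ ∂circleμ) = 1)
    (hps : ∀ s ∈ Set.Ico (0:ℝ) δ, ∀ θ : ℝ, HasDerivAt (fun t => p t θ) (ps s θ) s)
    (hcont : ContinuousOn (fun q : ℝ × ℝ => p q.1 q.2) (Set.Ico (0:ℝ) δ ×ˢ (Set.univ : Set ℝ)))
    (hcont' : ContinuousOn (fun q : ℝ × ℝ => ps q.1 q.2) (Set.Ico (0:ℝ) δ ×ˢ (Set.univ : Set ℝ)))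
    (hp0 : ∀ θ : ℝ, p 0 θ = 1)
    (hstat : ∀ s ∈ Set.Ico (0:ℝ) δ, ∀ θ : ℝ,
      deriv (p s) θ = κs s * deriv (fun θ' => ∫ φ, W (θ' - φ) * p s φ ∂circleμ) θ * p s θ)
    (hd1 : ∀ s ∈ Set.Ico (0:ℝ) δ,
      Real.sqrt (∑' ℓ : ℕ, (1 + ((ℓ + 1 : ℕ) : ℝ) ^ 2)
          * (denCoef (p s) (ℓ + 1) - s * (if (ℓ + 1) ∈ Λ then y (ℓ + 1) else 0)) ^ 2)
        ≤ C * s ^ 2)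
    (hd2 : ∀ s ∈ Set.Ico (0:ℝ) δ,
      Real.sqrt (∑' ℓ : ℕ, (1 + ((ℓ + 1 : ℕ) : ℝ) ^ 2)
          * (denCoef (ps s) (ℓ + 1) - (if (ℓ + 1) ∈ Λ then y (ℓ + 1) else 0)) ^ 2)
        ≤ C * s) :
    ∃ η : ℝ, 0 < η ∧ η < δ ∧
      freeEnergy W (p η) (2 / aval) < freeEnergy W (p 0) (2 / aval) := by
  have hπ := Real.pi_pos
  have h0mem : (0:ℝ) ∈ Set.Ico (0:ℝ) δ := ⟨le_rfl, hδ⟩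
  have sub : Set.Icc 0 (δ / 2) ⊆ Set.Ico 0 δ := fun x hx => ⟨hx.1, by linarith [hx.2]⟩
  have pc : ∀ t ∈ Set.Ico 0 δ, Continuous (p t) := fun t ht => aux_slice hcont ht
  have psc : ∀ t ∈ Set.Ico 0 δ, Continuous (ps t) := fun t ht => aux_slice hcont' ht
  have hev : ∀ᶠ s in 𝓝[>] (0:ℝ), s ∈ Set.Ioo 0 (δ / 2) := Ioo_mem_nhdsGT (by linarith)
  obtain ⟨M, hM⟩ := ((isCompact_Icc (a := (0:ℝ)) (b := δ / 2)).prod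
    (isCompact_Icc (a := (0:ℝ)) (b := 2 * π))).exists_bound_of_continuousOn
    (hcont'.mono (Set.prod_mono sub (Set.subset_univ _)))
  have hM0 : 0 ≤ M := (norm_nonneg _).trans
    (hM (0, 0) ⟨⟨le_rfl, by linarith⟩, ⟨le_rfl, by positivity⟩⟩)
  have hMr : ∀ s ∈ Set.Ioo 0 (δ / 2), ∀ θ ∈ Set.Icc (0:ℝ) (2 * π), |s⁻¹ * (p s θ - 1)| ≤ M := by
    intro s hs θ hθ
    have h1 := (convex_Icc (0:ℝ) (δ / 2)).norm_image_sub_le_of_norm_hasDerivWithin_le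
      (f := fun t => p t θ) (f' := fun t => ps t θ) (C := M)
      (fun x hx => (hps x (sub hx) θ).hasDerivWithinAt)
      (fun x hx => hM (x, θ) ⟨hx, hθ⟩) (x := 0) (y := s) ⟨le_rfl, by linarith⟩ ⟨hs.1.le, hs.2.le⟩
    simp only [hp0, sub_zero, Real.norm_eq_abs, abs_of_pos hs.1] at h1
    rw [abs_mul, abs_of_pos (inv_pos.2 hs.1), inv_mul_le_iff₀ hs.1, mul_comm]
    exact h1
  have hlim : ∀ θ, Tendsto (fun s => s⁻¹ * (p s θ - 1)) (𝓝[>] 0) (𝓝 (ps 0 θ)) := by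
    intro θ
    have := (hps 0 h0mem θ).tendsto_slope_zero_right
    simpa [hp0] using this
  -- limits
  have hqc : Continuous (ps 0) := psc 0 h0mem
  have hqe : ∀ θ, ps 0 (-θ) = ps 0 θ := by
    intro θ
    refine tendsto_nhds_unique_of_eventuallyEq (hlim (-θ)) (hlim θ) ?_
    filter_upwards [hev] with s hs
    rw [heven s ⟨hs.1.le, by linarith [hs.2]⟩]
  have hqp : Function.Periodic (ps 0) (2 * π) := by
    intro θ
    refine tendsto_nhds_unique_of_eventuallyEq (hlim (θ + 2 * π)) (hlim θ) ?_
    filter_upwards [hev] with s hs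
    rw [hper s ⟨hs.1.le, by linarith [hs.2]⟩]
  have hcoeflim : ∀ ℓ : ℕ, Tendsto (fun s => s⁻¹ * (denCoef (p s) ℓ - denCoef (p 0) ℓ))
      (𝓝[>] 0) (𝓝 (denCoef (ps 0) ℓ)) := by
    intro ℓ
    have h1 : Tendsto (fun s => ∫ θ, s⁻¹ * (p s θ - 1) * Real.cos (ℓ * θ) ∂circleμ)
        (𝓝[>] 0) (𝓝 (denCoef (ps 0) ℓ)) := by
      refine tendsto_integral_filter_of_dominated_convergence (fun _ => M) ?_ ?_
        (integrable_const _) ?_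
      · filter_upwards [hev] with s hs
        have := pc s ⟨hs.1.le, by linarith [hs.2]⟩
        exact Continuous.aestronglyMeasurable (by fun_prop)
      · filter_upwards [hev] with s hs
        filter_upwards [circle_ae] with θ hθ
        rw [Real.norm_eq_abs, abs_mul]
        calc _ ≤ M * 1 := mul_le_mul (hMr s hs θ hθ) (Real.abs_cos_le_one _) (abs_nonneg _) hM0
          _ = M := mul_one M
      · exact Filter.Eventually.of_forall fun θ => (hlim θ).mul_const _
    refine h1.congr' ?_
    filter_upwards [hev] with s hs
    have := pc s ⟨hs.1.le, by linarith [hs.2]⟩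
    unfold denCoef
    simp only [hp0]
    rw [← integral_sub (circle_int (by fun_prop)) (circle_int (by fun_prop)),
      ← integral_const_mul]
    congr 1; ext θ; ring
  have hcoef : ∀ ℓ : ℕ, denCoef (ps 0) (ℓ + 1) = if (ℓ + 1) ∈ Λ then y (ℓ + 1) else 0 := by
    intro ℓ
    have hb : ∀ s ∈ Set.Ico (0:ℝ) δ, _ := fun s hs =>
      coef_bound (hreg s hs) (hper s hs) (heven s hs) (hd1 s hs) ℓ
    have hz : denCoef (p 0) (ℓ + 1) = 0 := by
      have := hb 0 h0mem
      simpa using this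
    set c : ℝ := if (ℓ + 1) ∈ Λ then y (ℓ + 1) else 0
    refine tendsto_nhds_unique (hcoeflim (ℓ + 1)) ?_
    rw [tendsto_iff_norm_sub_tendsto_zero]
    have hid : Tendsto (fun s : ℝ => C * s) (𝓝[>] 0) (𝓝 0) := by
      have : Tendsto (fun s : ℝ => C * s) (𝓝 0) (𝓝 (C * 0)) := by
        exact (continuous_const.mul continuous_id).tendsto 0
      rw [mul_zero] at this
      exact this.mono_left nhdsWithin_le_nhds
    refine squeeze_zero' (Filter.Eventually.of_forall fun _ => norm_nonneg _) ?_ hid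
    filter_upwards [hev] with s hs
    have h := hb s ⟨hs.1.le, by linarith [hs.2]⟩
    have e : s⁻¹ * (denCoef (p s) (ℓ + 1) - denCoef (p 0) (ℓ + 1)) - c
        = s⁻¹ * (denCoef (p s) (ℓ + 1) - s * c) := by
      have := hs.1.ne'
      rw [hz, sub_zero]; field_simp
    rw [e, Real.norm_eq_abs, abs_mul, abs_of_pos (inv_pos.2 hs.1), inv_mul_le_iff₀ hs.1]
    calc _ ≤ C * s ^ 2 := h
      _ = s * (C * s) := by ring
  have hcoef0 : denCoef (ps 0) 0 = 0 := by
    refine tendsto_nhds_unique_of_eventuallyEq (hcoeflim 0)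
      (tendsto_const_nhds (x := (0:ℝ)) (f := 𝓝[>] (0:ℝ))) ?_
    filter_upwards [hev] with s hs
    have e : ∀ t ∈ Set.Ico (0:ℝ) δ, denCoef (p t) 0 = 1 := by
      intro t ht
      rw [← hmass t ht]
      simp [denCoef]
    rw [e s ⟨hs.1.le, by linarith [hs.2]⟩, e 0 h0mem]; simp
  have hqW : ∀ θ, cconv W (ps 0) θ = aval / 2 * ps 0 θ := by
    intro θ
    have hcc := cconv_cont hWc hqc
    have hce := cconv_even hWe hWper hqp hqe
    have hcp := cconv_per (g := ps 0) hWper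
    have := fourier_zero_of_coef (f := fun θ => cconv W (ps 0) θ - aval / 2 * ps 0 θ)
      (by fun_prop) (fun x => by simp only [hcp x, hqp x]) (fun x => by simp only [hce, hqe])
      (fun ℓ => ?_) θ
    · linarith
    · have e : denCoef (fun θ => cconv W (ps 0) θ - aval / 2 * ps 0 θ) ℓ
          = denCoef (cconv W (ps 0)) ℓ - aval / 2 * denCoef (ps 0) ℓ := by
        unfold denCoef
        rw [← integral_const_mul, ← integral_sub (circle_int (by fun_prop))
          (circle_int (by fun_prop))]
        congr 1; ext x; ring
      rw [e, cconv_coef hWc hWe hWper hqc]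
      rcases ℓ with _ | ℓ
      · rw [hcoef0]; ring
      · rw [hcoef]
        split_ifs with h
        · rw [(hΛ _ h).2]; ring
        · ring
  have hQ : 0 < ∫ z : ℝ × ℝ, W (z.1 - z.2) * ps 0 z.1 * ps 0 z.2 ∂(circleμ.prod circleμ) := by
    have e : ∫ z : ℝ × ℝ, W (z.1 - z.2) * ps 0 z.1 * ps 0 z.2 ∂(circleμ.prod circleμ)
        = aval / 2 * ∫ θ, ps 0 θ ^ 2 ∂circleμ := by
      rw [integral_prod _ (circle_int2 (by fun_prop)), ← integral_const_mul]
      congr 1; ext θ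
      have h1 : ∫ φ, W (θ - φ) * ps 0 θ * ps 0 φ ∂circleμ = ps 0 θ * cconv W (ps 0) θ := by
        unfold cconv
        rw [← integral_const_mul]
        congr 1; ext φ; ring
      rw [h1, hqW]; ring
    rw [e]
    have hnn : 0 ≤ ∫ θ, ps 0 θ ^ 2 ∂circleμ := integral_nonneg fun θ => sq_nonneg _
    refine mul_pos (by linarith) (lt_of_le_of_ne hnn fun hz => ?_)
    have hae := (integral_eq_zero_iff_of_nonneg (fun θ => sq_nonneg (ps 0 θ))
      (circle_int (by fun_prop))).1 hz.symm
    obtain ⟨i, hi⟩ := hΛne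
    obtain ⟨j, rfl⟩ : ∃ j, i = j + 1 := ⟨i - 1, by have := (hΛ i hi).1; omega⟩
    apply hy _ hi
    have h1 := hcoef j
    rw [if_pos hi] at h1
    rw [← h1]
    unfold denCoef
    apply integral_eq_zero_of_ae
    filter_upwards [hae] with θ hθ
    have : ps 0 θ = 0 := by simpa using hθ
    simp [this]
  have hdf : ∀ s ∈ Set.Ioo 0 δ, _ := fun s hs =>
    deriv_free (κ := 2 / aval) hWc hWe hWper hpos hper hreg hmass hps hcont hcont' hs
      (hstat s ⟨hs.1.le, hs.2⟩)
  obtain ⟨BW, hBW⟩ := ((isCompact_Icc (a := (0:ℝ)) (b := 2 * π)).prod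
    (isCompact_Icc (a := (0:ℝ)) (b := 2 * π))).exists_bound_of_continuousOn
    (f := fun z : ℝ × ℝ => W (z.1 - z.2)) (Continuous.continuousOn (by fun_prop))
  have hDlim : Tendsto (fun s => s⁻¹ * ∫ z : ℝ × ℝ, W (z.1 - z.2) * ps s z.1 * p s z.2
      ∂(circleμ.prod circleμ)) (𝓝[>] 0)
      (𝓝 (∫ z : ℝ × ℝ, W (z.1 - z.2) * ps 0 z.1 * ps 0 z.2 ∂(circleμ.prod circleμ))) := by
    have h1 : Tendsto (fun s => ∫ z : ℝ × ℝ, W (z.1 - z.2) * ps s z.1 * (s⁻¹ * (p s z.2 - 1))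
        ∂(circleμ.prod circleμ)) (𝓝[>] 0)
        (𝓝 (∫ z : ℝ × ℝ, W (z.1 - z.2) * ps 0 z.1 * ps 0 z.2 ∂(circleμ.prod circleμ))) := by
      refine tendsto_integral_filter_of_dominated_convergence (fun _ => BW * M * M) ?_ ?_
        (integrable_const _) ?_
      · filter_upwards [hev] with s hs
        have := pc s ⟨hs.1.le, by linarith [hs.2]⟩
        have := psc s ⟨hs.1.le, by linarith [hs.2]⟩
        exact Continuous.aestronglyMeasurable (by fun_prop)
      · filter_upwards [hev] with s hs
        filter_upwards [circle_ae2] with z hz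
        have b1 := hBW z hz
        have b2 := hM (s, z.1) ⟨⟨hs.1.le, hs.2.le⟩, hz.1⟩
        have b3 := hMr s hs z.2 hz.2
        rw [norm_mul, norm_mul, Real.norm_eq_abs (s⁻¹ * _)]
        have b0 : 0 ≤ BW := (norm_nonneg _).trans b1
        gcongr
      · refine Filter.Eventually.of_forall fun z => ?_
        have hc1 : Tendsto (fun s => ps s z.1) (𝓝[>] 0) (𝓝 (ps 0 z.1)) := by
          have h2 : ContinuousOn (fun s => ps s z.1) (Set.Ico 0 δ) :=
            hcont'.comp (f := fun s : ℝ => (s, z.1)) (by fun_prop)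
              (fun t ht => ⟨ht, Set.mem_univ _⟩)
          refine (h2 0 h0mem).mono_left ?_
          rw [nhdsWithin_Ico_eq_nhdsGE hδ]
          exact nhdsWithin_mono _ Set.Ioi_subset_Ici_self
        exact (hc1.const_mul _).mul (hlim z.2)
    refine h1.congr' ?_
    filter_upwards [hev] with s hs
    have hsδ : s ∈ Set.Ioo 0 δ := ⟨hs.1, by linarith [hs.2]⟩
    have := pc s ⟨hs.1.le, hsδ.2⟩
    have := psc s ⟨hs.1.le, hsδ.2⟩
    have hz : ∫ z : ℝ × ℝ, W (z.1 - z.2) * ps s z.1 ∂(circleμ.prod circleμ) = 0 := by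
      rw [integral_prod _ (circle_int2 (by fun_prop))]
      have e : ∀ θ, ∫ φ, W (θ - φ) * ps s θ ∂circleμ = (∫ φ, W φ ∂circleμ) * ps s θ := by
        intro θ
        rw [integral_mul_const, circle_sub_left hWper]
      simp only [e]
      rw [integral_const_mul, (hdf s hsδ).1, mul_zero]
    have e : ∀ z : ℝ × ℝ, W (z.1 - z.2) * ps s z.1 * (s⁻¹ * (p s z.2 - 1))
        = s⁻¹ * (W (z.1 - z.2) * ps s z.1 * p s z.2 - W (z.1 - z.2) * ps s z.1) := by
      intro z; ring
    simp only [e]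
    rw [integral_const_mul, integral_sub (circle_int2 (by fun_prop)) (circle_int2 (by fun_prop)),
      hz, sub_zero]
  have hDpos := hDlim.eventually (lt_mem_nhds hQ)
  obtain ⟨ε, hε, hεs⟩ := (mem_nhdsGT_iff_exists_Ioo_subset).1 (hDpos.and hev)
  have hε' : (0:ℝ) < ε := hε
  have hη : ε / 2 ∈ Set.Ioo 0 ε := ⟨by linarith, by linarith⟩
  have hη2 := (hεs hη).2
  refine ⟨ε / 2, by linarith, by linarith [hη2.2], ?_⟩
  have subη : Set.Icc 0 (ε / 2) ⊆ Set.Ico 0 δ := fun x hx => ⟨hx.1, by linarith [hx.2, hη2.2]⟩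
  have hanti : StrictAntiOn (fun t => freeEnergy W (p t) (2 / aval)) (Set.Icc 0 (ε / 2)) := by
    refine strictAntiOn_of_deriv_neg (convex_Icc _ _) ?_ ?_
    · have hc := hcont.mono (Set.prod_mono subη (le_refl Set.univ))
      have g1 : ContinuousOn (fun q : ℝ × ℝ × ℝ => p q.1 q.2.1)
          (Set.Icc (0:ℝ) (ε / 2) ×ˢ (Set.univ : Set (ℝ × ℝ))) :=
        hc.comp (f := fun q : ℝ × ℝ × ℝ => (q.1, q.2.1)) (by fun_prop)
          (fun q hq => ⟨hq.1, Set.mem_univ _⟩)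
      have g2 : ContinuousOn (fun q : ℝ × ℝ × ℝ => p q.1 q.2.2)
          (Set.Icc (0:ℝ) (ε / 2) ×ˢ (Set.univ : Set (ℝ × ℝ))) :=
        hc.comp (f := fun q : ℝ × ℝ × ℝ => (q.1, q.2.2)) (by fun_prop)
          (fun q hq => ⟨hq.1, Set.mem_univ _⟩)
      have gW : ContinuousOn (fun q : ℝ × ℝ × ℝ => W (q.2.1 - q.2.2))
          (Set.Icc (0:ℝ) (ε / 2) ×ˢ (Set.univ : Set (ℝ × ℝ))) :=
        Continuous.continuousOn (by fun_prop)
      have k1 := aux_continuousOn (μ := circleμ) isCompact_Icc circle_ae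
        (isCompact_Icc (a := (0:ℝ)) (b := ε / 2)) (h := fun t θ => p t θ * Real.log (p t θ))
        (hc.mul (hc.log fun q hq => (hpos _ (subη hq.1) _).ne'))
      have k2 := aux_continuousOn (μ := circleμ.prod circleμ) (isCompact_Icc.prod isCompact_Icc)
        circle_ae2 (isCompact_Icc (a := (0:ℝ)) (b := ε / 2))
        (h := fun t z => W (z.1 - z.2) * p t z.1 * p t z.2) ((gW.mul g1).mul g2)
      refine (k1.sub (k2.const_smul (2 / aval / 2))).congr fun t ht => ?_
      simp only [freeEnergy, interaction_prod hWc (pc t (subη ht))]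
      rfl
    · intro x hx
      rw [interior_Icc] at hx
      have hxδ : x ∈ Set.Ioo 0 δ := ⟨hx.1, by linarith [hx.2, hη2.2]⟩
      rw [(hdf x hxδ).2.deriv]
      have hD := (hεs ⟨hx.1, by linarith [hx.2]⟩ : _ ∧ _).1
      refine mul_neg_of_neg_of_pos (sub_neg.2 (hκlt x hxδ)) ?_
      exact (mul_pos_iff_of_pos_left (inv_pos.2 hx.1)).1 hD
  exact hanti ⟨le_rfl, by linarith⟩ ⟨by linarith, le_rfl⟩ (by linarith)
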